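/- For every prime integer d > 2, the Kronecker–Pauli matrices resolve the swap operator: (1/d) · Σ_{n,m=0}^{d−1} Π_{n,m} ⊗ Π_{n,m} = S, where S is the d²×d² swap matrix with entries S_{(a,b),(c,e)} = δ_{a,e} · δ_{b,c} for a, b, c, e ∈ {0,…,d−1} (i.e., the matrix of the map v ⊗ u ↦ u ⊗ v on ℂ^d ⊗ ℂ^d). -/

import Mathlib

open Matrix BigOperators

/-- The primitive `d`-th root of unity `w = exp(2πi/d)`. -/
noncomputable def ω (d : ℕ) : ℂ := Complex.exp (2 * Real.pi * Complex.I / d)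

/-- The Chrestenson matrix: `(C_d)_{y,x} = w^{x·y} / √d`. -/
noncomputable def chres (d : ℕ) : Matrix (Fin d) (Fin d) ℂ :=
  Matrix.of fun y x => ω d ^ ((x : ℕ) * (y : ℕ)) / (Real.sqrt d : ℂ)

/-- The Weyl matrix: `(U_{n,m})_{k,j} = w^{k·n}` if `j ≡ k + m (mod d)`, and `0` otherwise. -/
noncomputable def weyl (d n m : ℕ) : Matrix (Fin d) (Fin d) ℂ :=
  Matrix.of fun k j => if (j : ℕ) = ((k : ℕ) + m) % d then ω d ^ ((k : ℕ) * n) else 0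

/-- The Kronecker–Pauli matrix: `(Π_{n,m})_{k,j} = w^{(k-n)·m}` if `j ≡ -k + 2n (mod d)`,
and `0` otherwise. -/
noncomputable def kp (d n m : ℕ) : Matrix (Fin d) (Fin d) ℂ :=
  Matrix.of fun k j =>
    if (j : ℤ) = (-(k : ℤ) + 2 * (n : ℤ)) % (d : ℤ) then ω d ^ (((k : ℤ) - (n : ℤ)) * (m : ℤ))
    else 0

lemma omega_isPrimitiveRoot {d : ℕ} (hd : d ≠ 0) : IsPrimitiveRoot (ω d) d :=
  Complex.isPrimitiveRoot_exp d hd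

lemma sum_omega_zpow {d : ℕ} (hd : d ≠ 0) (z : ℤ) :
    ∑ m : Fin d, ω d ^ (z * ((m : ℕ) : ℤ)) = if (d : ℤ) ∣ z then (d : ℂ) else 0 := by
  have hω := omega_isPrimitiveRoot hd
  simp_rw [_root_.zpow_mul, zpow_natCast]
  rw [Fin.sum_univ_eq_sum_range (fun m => (ω d ^ z) ^ m) d]
  split_ifs with h
  · simp [(hω.zpow_eq_one_iff_dvd z).2 h]
  · have h1 : ω d ^ z ≠ 1 := fun h' => h ((hω.zpow_eq_one_iff_dvd z).1 h')
    rw [geom_sum_eq h1, ← zpow_natCast, ← _root_.zpow_mul, mul_comm, _root_.zpow_mul, zpow_natCast,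
      hω.pow_eq_one]
    simp

/-- A representative in `{0, …, d - 1}` is determined by its residue modulo `d`. -/
lemma fin_val_eq_emod_iff {d : ℕ} (j : Fin d) (z : ℤ) :
    ((j : ℕ) : ℤ) = z % (d : ℤ) ↔ (d : ℤ) ∣ z - ((j : ℕ) : ℤ) := by
  have hj : ((j : ℕ) : ℤ) < d := by exact_mod_cast j.2
  rw [← Int.modEq_iff_dvd, Int.ModEq, Int.emod_eq_of_lt (Int.natCast_nonneg _) hj]

lemma fin_eq_iff_dvd_sub {d : ℕ} (i j : Fin d) :
    i = j ↔ (d : ℤ) ∣ ((j : ℕ) : ℤ) - ((i : ℕ) : ℤ) := by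
  rw [← fin_val_eq_emod_iff, Int.emod_eq_of_lt (by positivity) (by exact_mod_cast j.2),
    Nat.cast_inj, Fin.ext_iff]

lemma exists_fin_dvd_sub_two_mul {d : ℕ} (hd : Odd d) (z : ℤ) :
    ∃ n : Fin d, (d : ℤ) ∣ z - 2 * ((n : ℕ) : ℤ) := by
  obtain ⟨r, hr⟩ := hd
  have hd0 : (0 : ℤ) < d := by omega
  have h0 := Int.emod_nonneg (z * (r + 1)) hd0.ne'
  have h1 := Int.emod_lt_of_pos (z * (r + 1)) hd0
  refine ⟨⟨(z * (r + 1) % d).toNat, by omega⟩, ?_⟩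
  simp only [Int.toNat_of_nonneg h0]
  refine ⟨2 * (z * (r + 1) / d) - z, ?_⟩
  have h2 := Int.emod_add_mul_ediv (z * (r + 1)) d
  have h3 : (d : ℤ) = 2 * r + 1 := by exact_mod_cast hr
  linear_combination -2 * h2 + z * h3

lemma sum_kp_mul_kp {d : ℕ} (hd : d ≠ 0) (n : ℕ) (a b c e : Fin d) :
    ∑ m : Fin d, kp d n (m : ℕ) a c * kp d n (m : ℕ) b e =
      if (a = e ∧ b = c) ∧ (d : ℤ) ∣ ((a : ℕ) : ℤ) + ((b : ℕ) : ℤ) - 2 * (n : ℤ)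
      then (d : ℂ) else 0 := by
  have hω : ω d ≠ 0 := (omega_isPrimitiveRoot hd).ne_zero hd
  have hsum := sum_omega_zpow hd (((a : ℕ) : ℤ) + ((b : ℕ) : ℤ) - 2 * (n : ℤ))
  have hiff : ((d : ℤ) ∣ ((a : ℕ) : ℤ) + ((b : ℕ) : ℤ) - 2 * (n : ℤ)) →
      ((((c : ℕ) : ℤ) = (-((a : ℕ) : ℤ) + 2 * (n : ℤ)) % (d : ℤ) ↔ b = c) ∧
       (((e : ℕ) : ℤ) = (-((b : ℕ) : ℤ) + 2 * (n : ℤ)) % (d : ℤ) ↔ a = e)) := by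
    intro h
    rw [eq_comm (a := b), eq_comm (a := a)]
    simp only [fin_val_eq_emod_iff, fin_eq_iff_dvd_sub]
    constructor
    · rw [← dvd_add_right h]; ring_nf
    · rw [← dvd_add_right h]; ring_nf
  have hterm : ∀ m : Fin d, kp d n (m : ℕ) a c * kp d n (m : ℕ) b e =
      if ((c : ℕ) : ℤ) = (-((a : ℕ) : ℤ) + 2 * (n : ℤ)) % (d : ℤ) ∧
        ((e : ℕ) : ℤ) = (-((b : ℕ) : ℤ) + 2 * (n : ℤ)) % (d : ℤ)
      then ω d ^ ((((a : ℕ) : ℤ) + ((b : ℕ) : ℤ) - 2 * (n : ℤ)) * ((m : ℕ) : ℤ)) else 0 := by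
    intro m
    simp only [kp, Matrix.of_apply]
    rw [ite_zero_mul_ite_zero, ← zpow_add₀ hω]
    ring_nf
  simp_rw [hterm]
  by_cases h : (d : ℤ) ∣ ((a : ℕ) : ℤ) + ((b : ℕ) : ℤ) - 2 * (n : ℤ)
  · simp only [hiff h, and_comm (a := b = c), h, and_true]
    split_ifs
    · simpa [h] using hsum
    · simp
  · rw [if_neg (fun h' => h h'.2)]
    split_ifs
    · simpa [h] using hsum
    · simp

theorem kp_swap (d : ℕ) (hd : d.Prime) (hd2 : 2 < d) :
    (1 / (d : ℂ)) •
        ∑ n : Fin d, ∑ m : Fin d,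
          Matrix.kroneckerMap (· * ·) (kp d (n : ℕ) (m : ℕ)) (kp d (n : ℕ) (m : ℕ)) =
      Matrix.of fun p q : Fin d × Fin d => if p.1 = q.2 ∧ p.2 = q.1 then (1 : ℂ) else 0 := by
  have hodd : Odd d := hd.odd_of_ne_two hd2.ne'
  have hd0 : (d : ℂ) ≠ 0 := Nat.cast_ne_zero.2 hd.ne_zero
  ext ⟨a, b⟩ ⟨c, e⟩
  simp only [Matrix.smul_apply, Matrix.sum_apply, Matrix.kroneckerMap_apply, Matrix.of_apply,
    sum_kp_mul_kp hd.ne_zero, smul_eq_mul]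
  split_ifs with h
  · obtain ⟨n₀, hn₀⟩ := exists_fin_dvd_sub_two_mul hodd (((a : ℕ) : ℤ) + ((b : ℕ) : ℤ))
    have hcop : IsCoprime (d : ℤ) 2 := by
      exact_mod_cast (Nat.isCoprime_iff_coprime.2 hodd.coprime_two_right)
    rw [Finset.sum_eq_single n₀]
    · rw [if_pos ⟨h, hn₀⟩, one_div_mul_cancel hd0]
    · intro n _ hne
      rw [if_neg]
      rintro ⟨-, hn⟩
      refine hne ((fin_eq_iff_dvd_sub n n₀).2 (hcop.dvd_of_dvd_mul_left ?_))
      have := dvd_sub hn hn₀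
      ring_nf at this ⊢
      exact this
    · simp
  · simp [h]
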